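/- Let A be an n×n real diagonal matrix with nonnegative entries and let P be an n×n diagonal matrix with strictly positive diagonal entries. Then ν₊(A;P,P) = ⟨A, P⟩ = Σᵢ Aᵢᵢ Pᵢᵢ. In particular, taking P = I, ν₊(A) = trace(A). -/

import Mathlib

open Matrix BigOperators

/-- A symmetric matrix `M` is copositive if `xᵀ M x ≥ 0` for every entrywise
nonnegative vector `x`. -/
def Copositive {k : Type*} [Fintype k] (M : Matrix k k ℝ) : Prop :=
  ∀ x : k → ℝ, (∀ i, 0 ≤ x i) → 0 ≤ x ⬝ᵥ M.mulVec x

/-- `ν₊(A; P, Q)`: the supremum of `⟨A, W⟩ = trace(Aᵀ W)` over all `W` such that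
the block matrix `[[P, −W], [−Wᵀ, Q]]` is copositive. -/
noncomputable def nuPlusPQ {m n : ℕ} (A : Matrix (Fin m) (Fin n) ℝ)
    (P : Matrix (Fin m) (Fin m) ℝ) (Q : Matrix (Fin n) (Fin n) ℝ) : ℝ :=
  sSup {t : ℝ | ∃ W : Matrix (Fin m) (Fin n) ℝ,
    Copositive (Matrix.fromBlocks P (-W) (-Wᵀ) Q) ∧ t = Matrix.trace (Aᵀ * W)}

/-- `ν₊(A) = ν₊(A; I, I)`. -/
noncomputable def nuPlus {m n : ℕ} (A : Matrix (Fin m) (Fin n) ℝ) : ℝ :=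
  nuPlusPQ A 1 1

theorem copositive_diag_block {n : ℕ} (p : Fin n → ℝ) (hp : ∀ i, 0 < p i) :
    Copositive (Matrix.fromBlocks (Matrix.diagonal p) (-(Matrix.diagonal p))
      (-(Matrix.diagonal p)ᵀ) (Matrix.diagonal p)) := by
  intro x _
  have h : x ⬝ᵥ (Matrix.fromBlocks (Matrix.diagonal p) (-(Matrix.diagonal p))
      (-(Matrix.diagonal p)ᵀ) (Matrix.diagonal p)).mulVec x
      = ∑ i, p i * (x (Sum.inl i) - x (Sum.inr i)) ^ 2 := by
    rw [Matrix.fromBlocks_mulVec]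
    simp only [dotProduct, Fintype.sum_sum_type, Sum.elim_inl, Sum.elim_inr, Pi.add_apply,
      Matrix.neg_mulVec, Pi.neg_apply, Matrix.diagonal_transpose, Matrix.mulVec_diagonal,
      Function.comp]
    rw [← Finset.sum_add_distrib]
    refine Finset.sum_congr rfl fun i _ => ?_
    ring
  rw [h]
  exact Finset.sum_nonneg fun i _ => mul_nonneg (hp i).le (sq_nonneg _)

theorem diag_le_of_copositive {n : ℕ} (p : Fin n → ℝ) (W : Matrix (Fin n) (Fin n) ℝ)
    (h : Copositive (Matrix.fromBlocks (Matrix.diagonal p) (-W) (-Wᵀ) (Matrix.diagonal p)))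
    (i : Fin n) : W i i ≤ p i := by
  have h1 := h (Sum.elim (Pi.single i 1) (Pi.single i 1)) (by
    rintro (j | j) <;> simp only [Sum.elim_inl, Sum.elim_inr, Pi.single_apply] <;>
      split_ifs <;> norm_num)
  rw [Matrix.fromBlocks_mulVec] at h1
  simp only [Sum.elim_comp_inl, Sum.elim_comp_inr, sumElim_dotProduct_sumElim,
    single_one_dotProduct, Pi.add_apply, Matrix.neg_apply,
    Matrix.mulVec_single_one, Matrix.col_apply, Matrix.transpose_apply,
    Matrix.diagonal_apply_eq] at h1
  linarith

theorem trace_diag_mul {n : ℕ} (a : Fin n → ℝ) (W : Matrix (Fin n) (Fin n) ℝ) :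
    Matrix.trace ((Matrix.diagonal a)ᵀ * W) = ∑ i, a i * W i i := by
  simp [Matrix.trace, Matrix.diagonal_mul]

theorem nuPlusPQ_diagonal_aux {n : ℕ} (a p : Fin n → ℝ)
    (ha : ∀ i, 0 ≤ a i) (hp : ∀ i, 0 < p i) :
    nuPlusPQ (Matrix.diagonal a) (Matrix.diagonal p) (Matrix.diagonal p) =
      ∑ i, a i * p i := by
  refine IsGreatest.csSup_eq ⟨⟨Matrix.diagonal p, copositive_diag_block p hp, ?_⟩, ?_⟩
  · rw [trace_diag_mul]; simp
  · rintro t ⟨W, hW, rfl⟩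
    rw [trace_diag_mul]
    exact Finset.sum_le_sum fun i _ =>
      mul_le_mul_of_nonneg_left (diag_le_of_copositive p W hW i) (ha i)

/-- For a nonnegative diagonal matrix `A` and a positive diagonal matrix `P`,
`ν₊(A;P,P) = ⟨A, P⟩ = Σᵢ Aᵢᵢ Pᵢᵢ`; in particular (taking `P = I`),
`ν₊(A) = trace A`. -/
theorem nuPlusPQ_diagonal {n : ℕ} (a p : Fin n → ℝ)
    (ha : ∀ i, 0 ≤ a i) (hp : ∀ i, 0 < p i) :
    nuPlusPQ (Matrix.diagonal a) (Matrix.diagonal p) (Matrix.diagonal p) =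
      ∑ i, a i * p i ∧
    nuPlus (Matrix.diagonal a) = Matrix.trace (Matrix.diagonal a) := by
  refine ⟨nuPlusPQ_diagonal_aux a p ha hp, ?_⟩
  have h := nuPlusPQ_diagonal_aux a (fun _ => 1) ha (fun _ => one_pos)
  rw [Matrix.diagonal_one] at h
  rw [nuPlus, h, Matrix.trace_diagonal]
  simp
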